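/- In ℂ(t)ˣ, there do not exist ε₁, ε₂ ∈ {0, 1} and nonzero f, g ∈ ℂ(t) such that (t²+1)^{ε₁}·(t⁴−1)^{ε₂} = f² and t^{1+ε₁}·(t²−1)^{ε₂} = g². Equivalently, the element (1, t) of (ℂ(t)ˣ/(ℂ(t)ˣ)²)² does not belong to the subgroup generated by (t²+1, t) and (t⁴−1, t²−1). -/

import Mathlib

/-- A polynomial with a simple root is not a square in the field of rational functions. -/
theorem RatFunc.algebraMap_ne_sq_of_simple_root {K : Type*} [Field K] {p : Polynomial K} {a : K}
    (h_root : p.eval a = 0) (h_simple : p.derivative.eval a ≠ 0) (f : RatFunc K) :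
    algebraMap (Polynomial K) (RatFunc K) p ≠ f ^ 2 := by
  intro h
  obtain ⟨r, rfl⟩ := IsIntegrallyClosed.exists_algebraMap_eq_of_isIntegral_pow
    (R := Polynomial K) (n := 2) two_pos (h ▸ isIntegral_algebraMap)
  rw [← map_pow] at h
  obtain rfl : p = r ^ 2 := RatFunc.algebraMap_injective K h
  have hr : r.eval a = 0 := by simpa using h_root
  exact h_simple (by simp [Polynomial.derivative_pow, hr])

/-- The class `(1, t)` of `(ℂ(t)ˣ/(ℂ(t)ˣ)²)²` does not lie in the subgroup generated by
`(t²+1, t)` and `(t⁴−1, t²−1)`: there are no `ε₁, ε₂ ∈ {0,1}` and nonzero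
`f, g ∈ ℂ(t)` with `(t²+1)^ε₁ (t⁴−1)^ε₂ = f²` and `t^{1+ε₁} (t²−1)^ε₂ = g²`. -/
theorem stmt10 : ¬ ∃ ε₁ ε₂ : ℕ, ε₁ ≤ 1 ∧ ε₂ ≤ 1 ∧
    ∃ f g : RatFunc ℂ, f ≠ 0 ∧ g ≠ 0 ∧
      (RatFunc.X ^ 2 + 1) ^ ε₁ * (RatFunc.X ^ 4 - 1) ^ ε₂ = f ^ 2 ∧
      RatFunc.X ^ (1 + ε₁) * (RatFunc.X ^ 2 - 1) ^ ε₂ = g ^ 2 := by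
  rintro ⟨ε₁, ε₂, h₁, h₂, f, g, -, -, hf, hg⟩
  interval_cases ε₁
  · refine RatFunc.algebraMap_ne_sq_of_simple_root (a := 0)
      (p := Polynomial.X * (Polynomial.X ^ 2 - 1) ^ ε₂) ?_ ?_ g ?_
    · simp
    · simp
    · simpa using hg
  · interval_cases ε₂
    · refine RatFunc.algebraMap_ne_sq_of_simple_root (a := Complex.I)
        (p := Polynomial.X ^ 2 + 1) ?_ ?_ f ?_
      · simp
      · simp
      · simpa using hf
    · refine RatFunc.algebraMap_ne_sq_of_simple_root (a := 1)
        (p := Polynomial.X ^ 2 * (Polynomial.X ^ 2 - 1)) ?_ ?_ g ?_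
      · simp
      · simp
      · simpa using hg
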